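/- Let T(x) = Σ t_i x^i be the ordinary generating function of increment-avoiding achievable permutations and S(x) = Σ s_n x^n that of all achievable permutations (for two stacks in series). Then S(x) = T(x/(1-x)) as formal power series; equivalently, s_n = Σ_{i=1}^{n} binomial(n-1, i-1) · t_i for all n ≥ 1. -/

import Mathlib

namespace TwoStacks

/-- A state of the two-stacks-in-series machine: remaining input,
stack 1, stack 2 (tops at the head), and the output so far. -/
structure St where
  inp : List ℕ
  s1 : List ℕ
  s2 : List ℕ
  out : List ℕ
deriving DecidableEq

/-- The three moves. -/
inductive Mv
  | rho  -- input → stack 1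
  | lam  -- stack 1 → stack 2
  | mu   -- stack 2 → output
deriving DecidableEq

/-- One move of the machine (`none` if the move is not applicable). -/
def step : Mv → St → Option St
  | .rho, ⟨x :: xs, s1, s2, o⟩ => some ⟨xs, x :: s1, s2, o⟩
  | .lam, ⟨i, x :: xs, s2, o⟩ => some ⟨i, xs, x :: s2, o⟩
  | .mu,  ⟨i, s1, x :: xs, o⟩ => some ⟨i, s1, xs, o ++ [x]⟩
  | _, _ => none

/-- Run a word of moves on a state. -/
def run (w : List Mv) (s : St) : Option St :=
  w.foldlM (fun s m => step m s) s

/-- The list 1,2,…,n. -/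
def idSeq (n : ℕ) : List ℕ := (List.range n).map (· + 1)

/-- The one-line notation p(1),…,p(n) (values in {1,…,n}) of a permutation. -/
def permList {n : ℕ} (p : Equiv.Perm (Fin n)) : List ℕ :=
  List.ofFn fun i => (p i : ℕ) + 1

/-- p is achievable: from input 1,…,n some word of moves outputs p(1),…,p(n). -/
def Achievable {n : ℕ} (p : Equiv.Perm (Fin n)) : Prop :=
  ∃ w, run w ⟨idSeq n, [], [], []⟩ = some ⟨[], [], [], permList p⟩

/-- p is sortable: from input p(1),…,p(n) some word of moves outputs 1,…,n. -/
def Sortable {n : ℕ} (p : Equiv.Perm (Fin n)) : Prop :=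
  ∃ w, run w ⟨permList p, [], [], []⟩ = some ⟨[], [], [], idSeq n⟩

/-- A list of (distinct) naturals is achievable as an output. -/
def AchList (l : List ℕ) : Prop :=
  ∃ w, run w ⟨idSeq l.length, [], [], []⟩ = some ⟨[], [], [], l⟩

/-- Standardization (pattern) of a list with distinct entries:
each entry is replaced by its rank (1-based). -/
def std (l : List ℕ) : List ℕ :=
  l.map fun x => (l.filter (· ≤ x)).length

/-- An operation sequence of length 3n: n of each letter, and every
prefix has #ρ ≥ #λ ≥ #μ. -/
def OpSeq (n : ℕ) (w : List Mv) : Prop :=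
  w.length = 3 * n ∧ w.count .rho = n ∧ w.count .lam = n ∧ w.count .mu = n ∧
  ∀ u, u <+: w → u.count .mu ≤ u.count .lam ∧ u.count .lam ≤ u.count .rho

/-- An x,y-Catalan word: word over {x,y} with equally many x's and y's
in which every prefix has at least as many x's as y's. -/
def CatWord (x y : Mv) (w : List Mv) : Prop :=
  (∀ m ∈ w, m = x ∨ m = y) ∧ w.count x = w.count y ∧
  ∀ u, u <+: w → u.count y ≤ u.count x

/-- Two words have the same effect: applied to any state on which both
are applicable, they give the same resulting state. -/
def SameEffect (v v' : List Mv) : Prop :=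
  ∀ s t t', run v s = some t → run v' s = some t' → t = t'

/-- Rank of a letter for the order ρ < λ < μ. -/
def rk : Mv → ℕ
  | .rho => 0
  | .lam => 1
  | .mu => 2

/-- The order ρ < λ < μ on letters. -/
def mlt (a b : Mv) : Prop := rk a < rk b

/-- Lexicographic order on words induced by ρ < λ < μ. -/
def wordLt (v v' : List Mv) : Prop := List.Lex mlt v v'

/-- No entry is immediately followed by its successor. -/
def IncAvoid (l : List ℕ) : Prop :=
  ∀ j (h : j + 1 < l.length), l.get ⟨j + 1, h⟩ ≠ l.get ⟨j, by omega⟩ + 1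

/-! ### Substituting blocks for letters -/

/-- Replace every entry `x` of a state by the block `g x`; the first stack stores blocks reversed. -/
def St.subst (g : ℕ → List ℕ) (s : St) : St :=
  ⟨s.inp.flatMap g, s.s1.flatMap fun x => (g x).reverse, s.s2.flatMap g, s.out.flatMap g⟩

theorem run_cons (m : Mv) (w : List Mv) (s : St) : run (m :: w) s = (step m s).bind (run w) := rfl

theorem run_append (u v : List Mv) (s : St) : run (u ++ v) s = (run u s).bind (run v) := by
  induction u generalizing s with
  | nil => rfl
  | cons m u ih =>
    rw [List.cons_append, run_cons, run_cons]
    cases step m s with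
    | none => rfl
    | some t => exact ih t

theorem run_replicate_rho (l i a b o : List ℕ) :
    run (List.replicate l.length .rho) ⟨l ++ i, a, b, o⟩ = some ⟨i, l.reverse ++ a, b, o⟩ := by
  induction l generalizing a with
  | nil => rfl
  | cons x l ih => simpa [List.replicate_succ, run_cons, step] using ih (x :: a)

theorem run_replicate_lam (l i a b o : List ℕ) :
    run (List.replicate l.length .lam) ⟨i, l ++ a, b, o⟩ = some ⟨i, a, l.reverse ++ b, o⟩ := by
  induction l generalizing b with
  | nil => rfl
  | cons x l ih => simpa [List.replicate_succ, run_cons, step] using ih (x :: b)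

theorem run_replicate_mu (l i a b o : List ℕ) :
    run (List.replicate l.length .mu) ⟨i, a, l ++ b, o⟩ = some ⟨i, a, b, o ++ l⟩ := by
  induction l generalizing o with
  | nil => simp [run]
  | cons x l ih => simpa [List.replicate_succ, run_cons, step] using ih (o ++ [x])

theorem exists_run_subst_of_step (g : ℕ → List ℕ) {m : Mv} {s t : St} (h : step m s = some t) :
    ∃ w, run w (s.subst g) = some (t.subst g) := by
  obtain ⟨i, a, b, o⟩ := s
  cases m with
  | rho =>
    cases i with
    | nil => simp [step] at h
    | cons x i =>
      simp only [step, Option.some.injEq] at h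
      subst h
      refine ⟨List.replicate (g x).length .rho, ?_⟩
      simpa [St.subst] using run_replicate_rho (g x) (i.flatMap g) _ _ _
  | lam =>
    cases a with
    | nil => simp [step] at h
    | cons x a =>
      simp only [step, Option.some.injEq] at h
      subst h
      refine ⟨List.replicate (g x).reverse.length .lam, ?_⟩
      simpa only [St.subst, List.flatMap_cons, List.reverse_reverse] using
        run_replicate_lam (g x).reverse (i.flatMap g) _ _ _
  | mu =>
    cases b with
    | nil => simp [step] at h
    | cons x b =>
      simp only [step, Option.some.injEq] at h
      subst h
      refine ⟨List.replicate (g x).length .mu, ?_⟩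
      simpa [St.subst] using run_replicate_mu (g x) (i.flatMap g) _ _ _

theorem exists_run_subst (g : ℕ → List ℕ) {w : List Mv} {s t : St} (h : run w s = some t) :
    ∃ w', run w' (s.subst g) = some (t.subst g) := by
  induction w generalizing s with
  | nil =>
    obtain rfl : s = t := by simpa [run] using h
    exact ⟨[], rfl⟩
  | cons m w ih =>
    rw [run_cons, Option.bind_eq_some_iff] at h
    obtain ⟨r, hr, h⟩ := h
    obtain ⟨u, hu⟩ := exists_run_subst_of_step g hr
    obtain ⟨v, hv⟩ := ih h
    exact ⟨u ++ v, by rw [run_append, hu]; exact hv⟩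

/-- The machine can turn the input `I` into the output `L`. -/
def Produces (I L : List ℕ) : Prop :=
  ∃ w, run w ⟨I, [], [], []⟩ = some ⟨[], [], [], L⟩

theorem Produces.flatMap {I L : List ℕ} (h : Produces I L) (g : ℕ → List ℕ) :
    Produces (I.flatMap g) (L.flatMap g) := by
  obtain ⟨w, hw⟩ := h
  exact exists_run_subst g hw

/-- All entries present in a state. -/
def St.entries (s : St) : List ℕ := s.inp ++ s.s1 ++ s.s2 ++ s.out

theorem entries_perm_of_step {m : Mv} {s t : St} (h : step m s = some t) :
    s.entries.Perm t.entries := by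
  obtain ⟨i, a, b, o⟩ := s
  cases m with
  | rho =>
    cases i with
    | nil => simp [step] at h
    | cons x i =>
      simp only [step, Option.some.injEq] at h
      subst h
      rw [← Multiset.coe_eq_coe]
      simp only [St.entries, ← Multiset.coe_add, ← Multiset.cons_coe, ← Multiset.singleton_add]
      abel
  | lam =>
    cases a with
    | nil => simp [step] at h
    | cons x a =>
      simp only [step, Option.some.injEq] at h
      subst h
      rw [← Multiset.coe_eq_coe]
      simp only [St.entries, ← Multiset.coe_add, ← Multiset.cons_coe, ← Multiset.singleton_add]
      abel
  | mu =>
    cases b with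
    | nil => simp [step] at h
    | cons x b =>
      simp only [step, Option.some.injEq] at h
      subst h
      rw [← Multiset.coe_eq_coe]
      simp only [St.entries, ← Multiset.coe_add, ← Multiset.cons_coe, ← Multiset.singleton_add,
        Multiset.coe_nil]
      abel

theorem entries_perm_of_run {w : List Mv} {s t : St} (h : run w s = some t) :
    s.entries.Perm t.entries := by
  induction w generalizing s with
  | nil =>
    obtain rfl : s = t := by simpa [run] using h
    exact .refl _
  | cons m w ih =>
    rw [run_cons, Option.bind_eq_some_iff] at h
    obtain ⟨r, hr, h⟩ := h
    exact (entries_perm_of_step hr).trans (ih h)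

theorem Produces.perm {I L : List ℕ} (h : Produces I L) : I.Perm L := by
  obtain ⟨w, hw⟩ := h
  simpa [St.entries] using entries_perm_of_run hw

theorem idSeq_succ (n : ℕ) : idSeq (n + 1) = idSeq n ++ [n + 1] := by
  simp [idSeq, List.range_succ]

theorem mem_idSeq {n x : ℕ} : x ∈ idSeq n ↔ 1 ≤ x ∧ x ≤ n := by
  simp only [idSeq, List.mem_map, List.mem_range]
  constructor
  · rintro ⟨a, ha, rfl⟩
    omega
  · rintro ⟨h₁, h₂⟩
    exact ⟨x - 1, by omega, by omega⟩

theorem nodup_idSeq (n : ℕ) : (idSeq n).Nodup :=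
  List.nodup_range.map (add_left_injective 1)

theorem length_idSeq (n : ℕ) : (idSeq n).length = n := by
  simp [idSeq]

theorem Produces.nodup {n : ℕ} {L : List ℕ} (h : Produces (idSeq n) L) : L.Nodup :=
  h.perm.nodup_iff.mp (nodup_idSeq n)

theorem Produces.mem_iff {n x : ℕ} {L : List ℕ} (h : Produces (idSeq n) L) :
    x ∈ L ↔ 1 ≤ x ∧ x ≤ n := by
  rw [← h.perm.mem_iff, mem_idSeq]

/-! ### Splitting a value into two consecutive ones, and merging them again -/

/-- The block replacing `x` when the value `v` is split into `v, v + 1`. -/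
def splitAt (v x : ℕ) : List ℕ :=
  if x < v then [x] else if x = v then [v, v + 1] else [x + 1]

/-- The block replacing `x` when the value `v + 1` is deleted and larger values move down. -/
def mergeAt (v x : ℕ) : List ℕ :=
  if x ≤ v then [x] else if x = v + 1 then [] else [x - 1]

theorem splitAt_of_lt {v x : ℕ} (h : x < v) : splitAt v x = [x] := by simp [splitAt, h]

theorem splitAt_self (v : ℕ) : splitAt v v = [v, v + 1] := by simp [splitAt]

theorem splitAt_of_gt {v x : ℕ} (h : v < x) : splitAt v x = [x + 1] := by
  simp [splitAt, h.not_gt, h.ne']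

theorem mergeAt_of_le {v x : ℕ} (h : x ≤ v) : mergeAt v x = [x] := by simp [mergeAt, h]

theorem mergeAt_succ_self (v : ℕ) : mergeAt v (v + 1) = [] := by simp [mergeAt]

theorem mergeAt_of_gt {v x : ℕ} (h : v + 1 < x) : mergeAt v x = [x - 1] := by
  simp [mergeAt, h.ne', (show ¬ x ≤ v by omega)]

theorem flatMap_splitAt_mergeAt (v : ℕ) (M : List ℕ) :
    (M.flatMap (splitAt v)).flatMap (mergeAt v) = M := by
  rw [List.flatMap_assoc]
  conv_rhs => rw [← List.flatMap_singleton' M]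
  refine List.flatMap_congr fun x _ => ?_
  rcases lt_trichotomy x v with h | rfl | h
  · simp [splitAt_of_lt h, mergeAt_of_le h.le]
  · simp [splitAt_self, mergeAt_of_le, mergeAt_succ_self]
  · simp [splitAt_of_gt h, mergeAt_of_gt (show v + 1 < x + 1 by omega)]

theorem flatMap_mergeAt_splitAt_of_notMem {v : ℕ} {M : List ℕ} (h₁ : v ∉ M) (h₂ : v + 1 ∉ M) :
    (M.flatMap (mergeAt v)).flatMap (splitAt v) = M := by
  rw [List.flatMap_assoc]
  conv_rhs => rw [← List.flatMap_singleton' M]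
  refine List.flatMap_congr fun x hx => ?_
  have hv : x ≠ v := fun e => h₁ (e ▸ hx)
  have hv' : x ≠ v + 1 := fun e => h₂ (e ▸ hx)
  rcases lt_or_gt_of_ne hv with h | h
  · simp [mergeAt_of_le h.le, splitAt_of_lt h]
  · rw [mergeAt_of_gt (by omega), List.flatMap_singleton, splitAt_of_gt (by omega)]
    congr 1
    omega

theorem flatMap_mergeAt_splitAt {v : ℕ} {L : List ℕ} (hL : L.Nodup) (h : [v, v + 1] <:+: L) :
    (L.flatMap (mergeAt v)).flatMap (splitAt v) = L := by
  obtain ⟨P, Q, rfl⟩ := h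
  have hP : v ∉ P ∧ v + 1 ∉ P := by
    simp only [List.append_assoc, List.nodup_append] at hL
    exact ⟨fun h => hL.2.2 _ h v (by simp) rfl, fun h => hL.2.2 _ h (v + 1) (by simp) rfl⟩
  have hQ : v ∉ Q ∧ v + 1 ∉ Q := by
    simp only [List.nodup_append] at hL
    exact ⟨fun h => hL.2.2 v (by simp) _ h rfl, fun h => hL.2.2 (v + 1) (by simp) _ h rfl⟩
  simp only [List.flatMap_append, flatMap_mergeAt_splitAt_of_notMem hP.1 hP.2,
    flatMap_mergeAt_splitAt_of_notMem hQ.1 hQ.2]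
  simp [mergeAt_of_le, mergeAt_succ_self, splitAt_self]

theorem flatMap_splitAt_idSeq {v n : ℕ} (hv : 1 ≤ v) (hn : v ≤ n) :
    (idSeq n).flatMap (splitAt v) = idSeq (n + 1) := by
  induction n, hn using Nat.le_induction with
  | base =>
    obtain ⟨k, rfl⟩ : ∃ k, v = k + 1 := ⟨v - 1, by omega⟩
    have h : (idSeq k).flatMap (splitAt (k + 1)) = idSeq k := by
      conv_rhs => rw [← List.flatMap_singleton' (idSeq k)]
      exact List.flatMap_congr fun x hx => splitAt_of_lt (by have := (mem_idSeq.mp hx).2; omega)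
    rw [idSeq_succ (k + 1), idSeq_succ k, List.flatMap_append, h]
    simp [splitAt_self]
  | succ n hn ih =>
    rw [idSeq_succ n, List.flatMap_append, ih, idSeq_succ (n + 1), List.flatMap_singleton,
      splitAt_of_gt (by omega)]

theorem flatMap_mergeAt_idSeq {v n : ℕ} (hv : 1 ≤ v) (hn : v ≤ n) :
    (idSeq (n + 1)).flatMap (mergeAt v) = idSeq n := by
  rw [← flatMap_splitAt_idSeq hv hn, flatMap_splitAt_mergeAt]

/-! ### Consecutive increments under splitting and merging -/

theorem infix_flatMap {A B : List ℕ} (h : A <:+: B) (g : ℕ → List ℕ) :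
    A.flatMap g <:+: B.flatMap g := by
  obtain ⟨P, Q, rfl⟩ := h
  exact ⟨P.flatMap g, Q.flatMap g, by simp⟩

theorem infix_flatMap_splitAt_of_lt {v x : ℕ} {M : List ℕ} (hx : x < v)
    (h : [x, x + 1] <:+: M) : [x, x + 1] <:+: M.flatMap (splitAt v) := by
  refine List.IsInfix.trans ?_ (infix_flatMap h (splitAt v))
  rcases (show x + 1 < v ∨ x + 1 = v by omega) with h' | rfl
  · exact ⟨[], [], by simp [splitAt_of_lt hx, splitAt_of_lt h']⟩
  · exact ⟨[], [x + 1 + 1], by simp [splitAt_of_lt hx, splitAt_self]⟩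

theorem infix_flatMap_splitAt_of_ge {v x : ℕ} {M : List ℕ} (hx : v ≤ x)
    (h : [x, x + 1] <:+: M) : [x + 1, x + 1 + 1] <:+: M.flatMap (splitAt v) := by
  refine List.IsInfix.trans ?_ (infix_flatMap h (splitAt v))
  have h' : v < x + 1 := by omega
  rcases hx.eq_or_lt with rfl | hx
  · exact ⟨[v], [], by simp [splitAt_self, splitAt_of_gt h']⟩
  · exact ⟨[], [], by simp [splitAt_of_gt hx, splitAt_of_gt h']⟩

theorem infix_flatMap_mergeAt_of_gt {v x : ℕ} {L : List ℕ} (hx : v + 1 < x)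
    (h : [x, x + 1] <:+: L) : [x - 1, x - 1 + 1] <:+: L.flatMap (mergeAt v) := by
  refine List.IsInfix.trans ?_ (infix_flatMap h (mergeAt v))
  refine ⟨[], [], ?_⟩
  have : x - 1 + 1 = x := by omega
  simp [mergeAt_of_gt hx, mergeAt_of_gt (show v + 1 < x + 1 by omega), this]

theorem infix_flatMap_mergeAt_of_infix {v : ℕ} {L : List ℕ} (hL : L.Nodup)
    (h : [v, v + 1] <:+: L) (h' : [v + 1, v + 1 + 1] <:+: L) :
    [v, v + 1] <:+: L.flatMap (mergeAt v) := by
  obtain ⟨P, Q, rfl⟩ := h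
  obtain ⟨R, S, e⟩ := h'
  have e' : (P ++ [v]) ++ (v + 1) :: Q = R ++ (v + 1) :: ((v + 1 + 1) :: S) := by simpa using e.symm
  have hnotMem : v + 1 ∉ P ++ [v] ∧ v + 1 ∉ Q := by
    have h := List.nodup_middle.mp (show ((P ++ [v]) ++ (v + 1) :: Q).Nodup by simpa using hL)
    rw [List.nodup_cons, List.mem_append, not_or] at h
    exact h.1
  obtain ⟨-, -, rfl⟩ := (List.append_cons_inj_of_notMem hnotMem.1 hnotMem.2).mp e'
  exact ⟨P.flatMap (mergeAt v), S.flatMap (mergeAt v), by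
    simp [mergeAt_of_le, mergeAt_succ_self, mergeAt_of_gt]⟩

/-! ### Counting -/

/-- Outputs from the input `1, …, n` in which every `x` immediately followed by `x + 1` is at
most `m`. -/
def outputs (n m : ℕ) : Set (List ℕ) :=
  {L | Produces (idSeq n) L ∧ ∀ x, [x, x + 1] <:+: L → x ≤ m}

theorem finite_outputs (n m : ℕ) : (outputs n m).Finite := by
  refine (List.finite_toSet (idSeq n).permutations).subset fun L hL => ?_
  exact List.mem_permutations.mpr hL.1.perm.symm

theorem bijOn_mergeAt {n m : ℕ} (h : m < n) :
    Set.BijOn (List.flatMap (mergeAt (m + 1)))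
      {L ∈ outputs (n + 1) (m + 1) | [m + 1, m + 1 + 1] <:+: L} (outputs n m) := by
  refine Set.InvOn.bijOn (f' := List.flatMap (splitAt (m + 1))) ⟨?_, ?_⟩ ?_ ?_
  · exact fun L hL => flatMap_mergeAt_splitAt hL.1.1.nodup hL.2
  · exact fun M _ => flatMap_splitAt_mergeAt (m + 1) M
  · rintro L ⟨⟨hp, hm⟩, hi⟩
    refine ⟨by simpa only [flatMap_mergeAt_idSeq (Nat.le_add_left 1 m) h] using
      hp.flatMap (mergeAt (m + 1)), fun x hx => ?_⟩
    by_contra! hlt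
    have := infix_flatMap_splitAt_of_ge (v := m + 1) hlt hx
    rw [flatMap_mergeAt_splitAt hp.nodup hi] at this
    have := hm _ this
    omega
  · rintro M ⟨hp, hm⟩
    have hp' : Produces (idSeq (n + 1)) (M.flatMap (splitAt (m + 1))) := by
      simpa only [flatMap_splitAt_idSeq (Nat.le_add_left 1 m) h] using
        hp.flatMap (splitAt (m + 1))
    have hi : [m + 1, m + 1 + 1] <:+: M.flatMap (splitAt (m + 1)) := by
      obtain ⟨P, Q, rfl⟩ := List.append_of_mem (hp.mem_iff.mpr ⟨Nat.le_add_left 1 m, h⟩)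
      exact ⟨P.flatMap (splitAt (m + 1)), Q.flatMap (splitAt (m + 1)), by simp [splitAt_self]⟩
    refine ⟨⟨hp', fun x hx => ?_⟩, hi⟩
    by_contra! hlt
    rcases (show x = m + 1 + 1 ∨ m + 1 + 1 < x by omega) with rfl | hlt
    · have := infix_flatMap_mergeAt_of_infix hp'.nodup hi hx
      rw [flatMap_splitAt_mergeAt] at this
      have := hm _ this
      omega
    · have := infix_flatMap_mergeAt_of_gt hlt hx
      rw [flatMap_splitAt_mergeAt] at this
      have := hm _ this
      omega

theorem ncard_outputs_succ {n m : ℕ} (h : m < n) :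
    (outputs (n + 1) (m + 1)).ncard = (outputs (n + 1) m).ncard + (outputs n m).ncard := by
  rw [← (bijOn_mergeAt h).ncard_eq, ← Set.ncard_union_eq ?_ (finite_outputs _ _)
    ((finite_outputs _ _).subset fun L hL => hL.1)]
  · congr 1
    ext L
    simp only [outputs, Set.mem_union, Set.mem_ofPred_eq]
    constructor
    · rintro ⟨hp, hm⟩
      by_cases hi : [m + 1, m + 1 + 1] <:+: L
      · exact Or.inr ⟨⟨hp, hm⟩, hi⟩
      · refine Or.inl ⟨hp, fun x hx => Nat.le_of_lt_succ ((hm x hx).lt_of_ne ?_)⟩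
        rintro rfl
        exact hi hx
    · rintro (⟨hp, hm⟩ | ⟨hL, -⟩)
      · exact ⟨hp, fun x hx => (hm x hx).trans m.le_succ⟩
      · exact hL
  · rw [Set.disjoint_left]
    rintro L ⟨-, hm⟩ ⟨-, hi⟩
    have := hm _ hi
    omega

theorem ncard_outputs {n m : ℕ} (h : m < n) :
    (outputs n m).ncard =
      ∑ k ∈ Finset.range (m + 1), m.choose k * (outputs (n - k) 0).ncard := by
  induction m generalizing n with
  | zero => simp
  | succ m ih =>
    obtain ⟨n, rfl⟩ : ∃ k, n = k + 1 := ⟨n - 1, by omega⟩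
    rw [ncard_outputs_succ (by omega), ih (by omega), ih (by omega),
      Finset.sum_range_succ' _ (m + 1)]
    have hs : ∑ k ∈ Finset.range (m + 1), m.choose k * (outputs (n + 1 - k) 0).ncard =
        ∑ k ∈ Finset.range (m + 2), m.choose k * (outputs (n + 1 - k) 0).ncard := by
      rw [Finset.sum_range_succ _ (m + 1)]
      simp
    rw [hs, Finset.sum_range_succ' _ (m + 1)]
    simp only [Nat.choose_succ_succ, add_mul, Finset.sum_add_distrib, Nat.add_sub_add_right,
      Nat.choose_zero_right]
    ring

/-! ### Permutations in one-line notation -/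

theorem permList_injective (n : ℕ) : Function.Injective (permList (n := n)) := by
  intro p q h
  ext i
  simpa using congrFun (List.ofFn_injective h) i

theorem exists_permList_eq {n : ℕ} {L : List ℕ} (h : (idSeq n).Perm L) :
    ∃ p : Equiv.Perm (Fin n), permList p = L := by
  have hlen : L.length = n := by rw [← h.length_eq, length_idSeq]
  subst hlen
  have hmem : ∀ i : Fin L.length, 1 ≤ L.get i ∧ L.get i ≤ L.length := fun i =>
    mem_idSeq.mp (h.mem_iff.mpr (L.get_mem i))
  have hinj : Function.Injective fun i : Fin L.length =>
      (⟨L.get i - 1, by have := hmem i; omega⟩ : Fin L.length) := by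
    intro i j hij
    refine List.nodup_iff_injective_get.mp (h.nodup_iff.mp (nodup_idSeq _)) ?_
    have := hmem i
    have := hmem j
    have := congrArg Fin.val hij
    simp only at this
    omega
  refine ⟨Equiv.ofBijective _ (Finite.injective_iff_bijective.mp hinj), ?_⟩
  conv_rhs => rw [← List.ofFn_get L]
  refine congrArg List.ofFn (funext fun i => ?_)
  have := hmem i
  simp only [Equiv.ofBijective_apply]
  omega

theorem card_achievable_and (n : ℕ) (Q : List ℕ → Prop) :
    Nat.card {p : Equiv.Perm (Fin n) // Achievable p ∧ Q (permList p)} =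
      {L | Produces (idSeq n) L ∧ Q L}.ncard := by
  change Set.ncard {p : Equiv.Perm (Fin n) | Achievable p ∧ Q (permList p)} = _
  rw [← Set.ncard_image_of_injective _ (permList_injective n)]
  congr 1
  ext L
  constructor
  · rintro ⟨p, hp, rfl⟩
    exact hp
  · rintro ⟨hp, hQ⟩
    obtain ⟨p, rfl⟩ := exists_permList_eq hp.perm
    exact ⟨p, ⟨hp, hQ⟩, rfl⟩

theorem incAvoid_iff {L : List ℕ} : IncAvoid L ↔ ∀ x, ¬ [x, x + 1] <:+: L := by
  constructor
  · rintro h x ⟨P, Q, rfl⟩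
    refine h P.length (by simp) ?_
    simp
  · intro h j hj e
    refine h (L.get ⟨j, by omega⟩) ⟨L.take j, L.drop (j + 2), ?_⟩
    rw [← e]
    conv_rhs => rw [← List.take_append_drop j L, List.drop_eq_getElem_cons (by omega),
      List.drop_eq_getElem_cons hj]
    simp

theorem card_achievable {n : ℕ} (hn : 1 ≤ n) :
    Nat.card {p : Equiv.Perm (Fin n) // Achievable p} = (outputs n (n - 1)).ncard := by
  have h := card_achievable_and n fun _ => True
  simp only [and_true] at h
  rw [h]
  congr 1
  ext L
  refine ⟨fun hp => ⟨hp, fun x hx => ?_⟩, fun hL => hL.1⟩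
  have : x + 1 ∈ L := hx.subset (by simp)
  have := (Produces.mem_iff hp).mp this
  omega

theorem card_achievable_incAvoid (n : ℕ) :
    Nat.card {p : Equiv.Perm (Fin n) // Achievable p ∧ IncAvoid (permList p)} =
      (outputs n 0).ncard := by
  rw [card_achievable_and]
  congr 1
  ext L
  simp only [outputs, Set.mem_ofPred_eq, incAvoid_iff]
  refine and_congr_right fun hp => forall_congr' fun x => ⟨fun h hx => (h hx).elim, fun h hx => ?_⟩
  have := (hp.mem_iff.mp (hx.subset (List.mem_cons_self : x ∈ [x, x + 1]))).1
  have := h hx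
  omega

theorem achievable_binomial_transform (n : ℕ) (hn : 1 ≤ n) :
    Nat.card {p : Equiv.Perm (Fin n) // Achievable p} =
      ∑ i ∈ Finset.Icc 1 n, (n - 1).choose (i - 1) *
        Nat.card {p : Equiv.Perm (Fin i) // Achievable p ∧ IncAvoid (permList p)} := by
  rw [card_achievable hn, ncard_outputs (by omega), Finset.sum_bij' (fun k _ => n - k)
    (fun i _ => n - i)]
  · intro k hk
    simp only [Finset.mem_range] at hk
    simp only [Finset.mem_Icc]
    omega
  · intro i hi
    simp only [Finset.mem_Icc] at hi
    simp only [Finset.mem_range]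
    omega
  · intro k hk
    simp only [Finset.mem_range] at hk
    omega
  · intro i hi
    simp only [Finset.mem_Icc] at hi
    omega
  · intro k hk
    simp only [Finset.mem_range] at hk
    rw [card_achievable_incAvoid, ← Nat.choose_symm (show k ≤ n - 1 by omega),
      show n - 1 - k = n - k - 1 by omega]


end TwoStacks
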